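/- arXiv:1603.03426 — 2 statements merged into one kernel-verified Lean document; each statement's English description precedes it below -/
import Mathlib

section
/- Let p ∈ (1,∞) with conjugate exponent q. The set G^p of (p,q)-integral operators is a right ideal of B(L^p(ℝ)): for every k ∈ L^p(ℝ;L^q(ℝ)) and every bounded operator T on L^p(ℝ), there exists k̃ ∈ L^p(ℝ;L^q(ℝ)) such that (Int k)∘T = Int k̃. -/
open MeasureTheory Complex Filter Topology
open scoped ENNReal NNReal

noncomputable section

/-- `L^p(ℝ)` with complex values. -/
abbrev LpR (p : ℝ≥0∞) := MeasureTheory.Lp ℂ p (volume : Measure ℝ)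

/-- The Bochner space `L^p(ℝ; L^q(ℝ))`. -/
abbrev LpLq (p q : ℝ≥0∞) [Fact (1 ≤ q)] := MeasureTheory.Lp (LpR q) p (volume : Measure ℝ)

/-- `T` is the operator of multiplication by `φ`. -/
def IsMulOp (p : ℝ≥0∞) [Fact (1 ≤ p)] (φ : ℝ → ℂ) (T : LpR p →L[ℂ] LpR p) : Prop :=
  ∀ f : LpR p, (T f : ℝ → ℂ) =ᵐ[volume] fun x => φ x * (f : ℝ → ℂ) x

/-- `T` is the operator of translation by `μ`: `(T f)(x) = f (x - μ)`. -/
def IsTransOp (p : ℝ≥0∞) [Fact (1 ≤ p)] (μ : ℝ) (T : LpR p →L[ℂ] LpR p) : Prop :=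
  ∀ f : LpR p, (T f : ℝ → ℂ) =ᵐ[volume] fun x => (f : ℝ → ℂ) (x - μ)

/-- A set of operators is closed in the strong operator topology (the topology of
pointwise norm convergence) if it contains every operator which is an SOT-limit point. -/
def IsSOTClosed (p : ℝ≥0∞) [Fact (1 ≤ p)] (S : Set (LpR p →L[ℂ] LpR p)) : Prop :=
  ∀ T : LpR p →L[ℂ] LpR p,
    (⇑T ∈ closure ((fun A : LpR p →L[ℂ] LpR p => (A : LpR p → LpR p)) '' S)) → T ∈ S

/-- The generators of the parabolic algebra: multiplications `M_λ`, `λ ≥ 0`, and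
translations `D_μ`, `μ ≥ 0`. -/
def parabolicGens (p : ℝ≥0∞) [Fact (1 ≤ p)] : Set (LpR p →L[ℂ] LpR p) :=
  {T | ∃ l : ℝ, 0 ≤ l ∧ IsMulOp p (fun x => Complex.exp (Complex.I * l * x)) T} ∪
  {T | ∃ m : ℝ, 0 ≤ m ∧ IsTransOp p m T}

/-- The parabolic algebra: the smallest SOT-closed subalgebra of `B(L^p(ℝ))` containing
the multiplication semigroup and the translation semigroup. -/
def parabolicAlgebra (p : ℝ≥0∞) [Fact (1 ≤ p)] : Set (LpR p →L[ℂ] LpR p) :=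
  ⋂₀ {S | parabolicGens p ⊆ S ∧ IsSOTClosed p S ∧
      ∃ A : Subalgebra ℂ (LpR p →L[ℂ] LpR p), (A : Set (LpR p →L[ℂ] LpR p)) = S}

/-- The Hardy space `H^p(ℝ)`, as a subset of `L^p(ℝ)`. -/
def hardy (p : ℝ≥0∞) [Fact (1 ≤ p)] : Set (LpR p) :=
  {f | ∀ u : ℂ, 0 < u.im → ∫ x : ℝ, (f : ℝ → ℂ) x / ((x : ℂ) + u) = 0}

/-- `L^p[t,∞)`, the subspace of functions vanishing a.e. on `(-∞, t)`. -/
def LpHalfLine (p : ℝ≥0∞) [Fact (1 ≤ p)] (t : ℝ) : Set (LpR p) :=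
  {f | ∀ᵐ x : ℝ, x < t → (f : ℝ → ℂ) x = 0}

/-- The image of the Hardy space under multiplication by the function `φ`. -/
def mulHardy (p : ℝ≥0∞) [Fact (1 ≤ p)] (φ : ℝ → ℂ) : Set (LpR p) :=
  {g | ∃ f ∈ hardy p, (g : ℝ → ℂ) =ᵐ[volume] fun x => φ x * (f : ℝ → ℂ) x}

/-- The Fourier binest algebra: operators leaving invariant each `L^p[t,∞)` and each
`e^{iλx}H^p(ℝ)`. -/
def fourierBinest (p : ℝ≥0∞) [Fact (1 ≤ p)] : Set (LpR p →L[ℂ] LpR p) :=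
  {T | (∀ t : ℝ, ∀ f ∈ LpHalfLine p t, T f ∈ LpHalfLine p t) ∧
       (∀ l : ℝ, ∀ f ∈ mulHardy p (fun x => Complex.exp (Complex.I * l * x)),
          T f ∈ mulHardy p (fun x => Complex.exp (Complex.I * l * x)))}

/-- `T` is the `(p,q)`-integral operator with kernel `k`. -/
def IsIntOp (p q : ℝ≥0∞) [Fact (1 ≤ p)] [Fact (1 ≤ q)] (k : LpLq p q)
    (T : LpR p →L[ℂ] LpR p) : Prop :=
  ∀ f : LpR p, (T f : ℝ → ℂ) =ᵐ[volume]
    fun x => ∫ y : ℝ, ((k : ℝ → LpR q) x : ℝ → ℂ) y * (f : ℝ → ℂ) y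

/-- `G^p`, the set of `(p,q)`-integral operators on `L^p(ℝ)`. -/
def Gp (p q : ℝ≥0∞) [Fact (1 ≤ p)] [Fact (1 ≤ q)] : Set (LpR p →L[ℂ] LpR p) :=
  {T | ∃ k : LpLq p q, IsIntOp p q k T}



section LpDual

variable {α : Type*} [MeasurableSpace α] {μ : Measure α} {p q : ℝ≥0∞}

/-- Radon–Nikodym for complex measures. -/
lemma ComplexMeasure.setIntegral_rnDeriv [SigmaFinite μ] {v : ComplexMeasure α}
    (hv : v ≪ᵥ μ.toENNRealVectorMeasure) {A : Set α} (hA : MeasurableSet A) :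
    ∫ x in A, v.rnDeriv μ x ∂μ = v A := by
  obtain ⟨hre, him⟩ := (v.absolutelyContinuous_ennreal_iff _).1 hv
  have hre' := SignedMeasure.withDensityᵥ_rnDeriv_eq _ μ hre
  have him' := SignedMeasure.withDensityᵥ_rnDeriv_eq _ μ him
  have hint := (v.integrable_rnDeriv μ).integrableOn (s := A)
  have h1 : (∫ x in A, v.rnDeriv μ x ∂μ).re = (v A).re := by
    rw [← RCLike.re_eq_complex_re, ← integral_re hint]
    have := congrArg (fun w => w A) hre'
    rwa [withDensityᵥ_apply (SignedMeasure.integrable_rnDeriv _ _) hA] at this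
  have h2 : (∫ x in A, v.rnDeriv μ x ∂μ).im = (v A).im := by
    rw [← RCLike.im_eq_complex_im, ← integral_im hint]
    have := congrArg (fun w => w A) him'
    rwa [withDensityᵥ_apply (SignedMeasure.integrable_rnDeriv _ _) hA] at this
  exact Complex.ext h1 h2

lemma indicatorConstLp_biUnion_finset {E ι : Type*} [NormedAddCommGroup E] {f : ι → Set α}
    (hf : ∀ i, MeasurableSet (f i)) (hd : Pairwise (Function.onFun Disjoint f))
    (hμ : ∀ i, μ (f i) ≠ ⊤) (c : E) (s : Finset ι)
    (hs : MeasurableSet (⋃ i ∈ s, f i)) (hμs : μ (⋃ i ∈ s, f i) ≠ ⊤) :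
    indicatorConstLp p hs hμs c = ∑ i ∈ s, indicatorConstLp p (hf i) (hμ i) c := by
  classical
  induction s using Finset.induction_on with
  | empty => simp
  | insert a s ha ih =>
    have hs' : MeasurableSet (⋃ i ∈ s, f i) := s.measurableSet_biUnion fun i _ => hf i
    have hμs' : μ (⋃ i ∈ s, f i) ≠ ⊤ :=
      ne_top_of_le_ne_top hμs (measure_mono (by
        rw [Finset.set_biUnion_insert]; exact Set.subset_union_right))
    have hdis : Disjoint (f a) (⋃ i ∈ s, f i) := by
      simp only [Set.disjoint_iUnion_right]
      intro i hi
      exact hd (by rintro rfl; exact ha hi)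
    rw [Finset.sum_insert ha, ← ih hs' hμs', ← indicatorConstLp_disjoint_union _ _ _ _ hdis]
    congr 1
    exact Finset.set_biUnion_insert a s f

/-- A continuous linear functional on `L^p` restricts to a complex measure on each set of finite
measure. -/
lemma exists_complexMeasure_eq_dual_indicator [Fact (1 ≤ p)] (hp : p ≠ ⊤)
    (φ : Lp ℂ p μ →L[ℂ] ℂ) {S : Set α} (hS : MeasurableSet S) (hμS : μ S ≠ ⊤) :
    ∃ v : ComplexMeasure α, ∀ (A : Set α) (hA : MeasurableSet A) (hμA : μ A ≠ ⊤), A ⊆ S →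
      v A = φ (indicatorConstLp p hA hμA 1) := by
  classical
  have hfin : ∀ A : Set α, μ (A ∩ S) ≠ ⊤ := fun A =>
    ne_top_of_le_ne_top hμS (measure_mono Set.inter_subset_right)
  let v : ComplexMeasure α :=
    { measureOf' := fun A => if hA : MeasurableSet A then
        φ (indicatorConstLp p (hA.inter hS) (hfin A) 1) else 0
      empty' := by simp
      not_measurable' := fun A hA => by simp [hA]
      m_iUnion' := by
        intro f hf hd
        have hf' : ∀ i, MeasurableSet (f i ∩ S) := fun i => (hf i).inter hS
        have hd' : Pairwise (Function.onFun Disjoint fun i => f i ∩ S) := fun i j hij =>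
          (hd hij).mono Set.inter_subset_left Set.inter_subset_left
        have hU : ∀ s : Finset ℕ, MeasurableSet (⋃ i ∈ s, f i ∩ S) := fun s =>
          s.measurableSet_biUnion fun i _ => hf' i
        have hμU : ∀ s : Finset ℕ, μ (⋃ i ∈ s, f i ∩ S) ≠ ⊤ := fun s =>
          ne_top_of_le_ne_top hμS (measure_mono (by simp))
        simp only [hf, MeasurableSet.iUnion hf, dif_pos]
        have hsum : ∑' i, μ (f i ∩ S) ≠ ⊤ := by
          rw [← measure_iUnion hd' hf']
          exact ne_top_of_le_ne_top hμS (measure_mono (by simp))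
        have hlim : Tendsto (fun s : Finset ℕ => indicatorConstLp p (hU s) (hμU s) (1 : ℂ)) atTop
            (𝓝 (indicatorConstLp p ((MeasurableSet.iUnion hf).inter hS) (hfin _) 1)) := by
          refine tendsto_indicatorConstLp_set hp ?_
          refine tendsto_of_tendsto_of_tendsto_of_le_of_le tendsto_const_nhds
            (ENNReal.tendsto_tsum_compl_atTop_zero hsum) (fun _ => zero_le) fun s => ?_
          refine le_trans (measure_mono ?_)
            (measure_iUnion_le (μ := μ) fun b : {i // i ∉ s} => f b ∩ S)
          rintro x (⟨hx, hx'⟩ | ⟨⟨hx, hxS⟩, hx'⟩)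
          · simp only [Set.mem_iUnion, Set.mem_inter_iff] at hx hx' ⊢
            obtain ⟨i, -, hi, hiS⟩ := hx
            exact absurd ⟨⟨i, hi⟩, hiS⟩ hx'
          · simp only [Set.mem_iUnion, Set.mem_inter_iff, not_exists] at hx hx' ⊢
            obtain ⟨i, hi⟩ := hx
            exact ⟨⟨i, fun his => hx' i his ⟨hi, hxS⟩⟩, hi, hxS⟩
        have := (φ.continuous.tendsto _).comp hlim
        refine this.congr fun s => ?_
        simp only [Function.comp_apply]
        rw [indicatorConstLp_biUnion_finset hf' hd' (fun i => hfin _) 1 s, map_sum] }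
  refine ⟨v, fun A hA hμA hAS => ?_⟩
  change (if hA : MeasurableSet A then
        φ (indicatorConstLp p (hA.inter hS) (hfin A) 1) else 0) = _
  rw [dif_pos hA]
  congr 2
  exact Set.inter_eq_left.2 hAS

lemma exists_integrable_eq_dual_indicator [SigmaFinite μ] [Fact (1 ≤ p)] (hp : p ≠ ⊤)
    (φ : Lp ℂ p μ →L[ℂ] ℂ) {S : Set α} (hS : MeasurableSet S) (hμS : μ S ≠ ⊤) :
    ∃ g : α → ℂ, Measurable g ∧ Integrable g μ ∧
      ∀ (A : Set α) (hA : MeasurableSet A) (hμA : μ A ≠ ⊤), A ⊆ S →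
        φ (indicatorConstLp p hA hμA 1) = ∫ x in A, g x ∂μ := by
  obtain ⟨v, hv⟩ := exists_complexMeasure_eq_dual_indicator hp φ hS hμS
  let w : ComplexMeasure α := v.restrict S
  have hw : ∀ A, MeasurableSet A → w A = v (A ∩ S) := fun A hA =>
    VectorMeasure.restrict_apply v hS hA
  have hac : w ≪ᵥ μ.toENNRealVectorMeasure := by
    refine VectorMeasure.AbsolutelyContinuous.mk fun A hA h0 => ?_
    rw [Measure.toENNRealVectorMeasure_apply_measurable hA] at h0
    have h0' : μ (A ∩ S) = 0 := measure_mono_null Set.inter_subset_left h0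
    rw [hw A hA, hv _ (hA.inter hS) (by simp [h0']) Set.inter_subset_right]
    convert map_zero φ
    rw [← norm_eq_zero]
    refine le_antisymm (norm_indicatorConstLp_le.trans ?_) (norm_nonneg _)
    have : p.toReal ≠ 0 :=
      (ENNReal.toReal_pos (zero_lt_one.trans_le (Fact.out : 1 ≤ p)).ne' hp).ne'
    simp [Measure.real, h0', Real.zero_rpow, this]
  refine ⟨w.rnDeriv μ, ?_, w.integrable_rnDeriv μ, fun A hA hμA hAS => ?_⟩
  · have h1 := (ComplexMeasure.re w).measurable_rnDeriv μ
    have h2 := (ComplexMeasure.im w).measurable_rnDeriv μ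
    convert (Complex.measurable_ofReal.comp h1).add
      ((Complex.measurable_ofReal.comp h2).mul_const Complex.I) using 1
    ext x
    apply Complex.ext <;> simp [ComplexMeasure.rnDeriv]
  · rw [ComplexMeasure.setIntegral_rnDeriv hac hA, hw A hA, Set.inter_eq_left.2 hAS, hv A hA hμA hAS]

/-- A continuous linear functional on `L^p` has a density, at least against indicators of sets
contained in some `spanningSets μ n`. -/
lemma exists_measurable_eq_dual_indicator [SigmaFinite μ] [Fact (1 ≤ p)] (hp : p ≠ ⊤)
    (φ : Lp ℂ p μ →L[ℂ] ℂ) :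
    ∃ h : α → ℂ, Measurable h ∧ ∀ (n : ℕ) (A : Set α) (hA : MeasurableSet A) (hμA : μ A ≠ ⊤),
      A ⊆ {x | spanningSetsIndex μ x < n} → IntegrableOn h A μ ∧
        φ (indicatorConstLp p hA hμA 1) = ∫ x in A, h x ∂μ := by
  choose g hgm hgi hg using fun n => exists_integrable_eq_dual_indicator hp φ
    (measurableSet_spanningSets μ n) (measure_spanningSets_lt_top μ n).ne
  have hidx := measurableSet_spanningSetsIndex μ
  refine ⟨fun x => g (spanningSetsIndex μ x) x, ?_, fun n => ?_⟩
  · exact (measurable_from_prod_countable_right (f := fun z : ℕ × α => g z.1 z.2) hgm).comp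
      (hidx.prodMk measurable_id)
  induction n with
  | zero =>
    intro A hA hμA hAS
    obtain rfl : A = ∅ := by
      ext x
      simpa using fun hx => by simpa using hAS hx
    simp
  | succ n ih =>
    intro A hA hμA hAS
    have hlt : MeasurableSet {x | spanningSetsIndex μ x < n} :=
      measurableSet_lt hidx measurable_const
    have heq : MeasurableSet {x | spanningSetsIndex μ x = n} := hidx (measurableSet_singleton n)
    set B := A ∩ {x | spanningSetsIndex μ x < n}
    set C := A ∩ {x | spanningSetsIndex μ x = n}
    have hB : MeasurableSet B := hA.inter hlt
    have hC : MeasurableSet C := hA.inter heq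
    have hμB : μ B ≠ ⊤ := ne_top_of_le_ne_top hμA (measure_mono Set.inter_subset_left)
    have hμC : μ C ≠ ⊤ := ne_top_of_le_ne_top hμA (measure_mono Set.inter_subset_left)
    have hdis : Disjoint B C := by
      rw [Set.disjoint_left]
      rintro x ⟨-, hx⟩ ⟨-, hx'⟩
      exact absurd hx' (ne_of_lt hx)
    have hBC : A = B ∪ C := by
      rw [← Set.inter_union_distrib_left, Set.left_eq_inter]
      intro x hx
      exact Nat.lt_succ_iff_lt_or_eq.1 (hAS hx)
    obtain ⟨hiB, hφB⟩ := ih B hB hμB Set.inter_subset_right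
    have hcongr : Set.EqOn (g n) (fun x => g (spanningSetsIndex μ x) x) C := by
      rintro x ⟨-, hx⟩
      simp only [Set.mem_ofPred_eq] at hx
      simp [hx]
    have hiC : IntegrableOn (fun x => g (spanningSetsIndex μ x) x) C μ :=
      (hgi n).integrableOn.congr_fun hcongr hC
    have hφC : φ (indicatorConstLp p hC hμC 1) = ∫ x in C, g (spanningSetsIndex μ x) x ∂μ := by
      rw [hg n C hC hμC, setIntegral_congr_fun hC hcongr]
      rintro x ⟨-, hx⟩
      exact mem_spanningSets_of_index_le μ x (le_of_eq hx)
    refine ⟨hBC ▸ hiB.union hiC, ?_⟩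
    have h1 : indicatorConstLp p hA hμA (1 : ℂ) =
        indicatorConstLp p hB hμB 1 + indicatorConstLp p hC hμC 1 := by
      rw [← indicatorConstLp_disjoint_union _ _ _ _ hdis]
      congr 1
    rw [h1, map_add, hφB, hφC, ← setIntegral_union hdis hC hiB hiC, ← hBC]

/-- The pairing `(g, f) ↦ ∫ g f` between `L^q` and `L^p`, for conjugate exponents. -/
abbrev lpMulPairing (μ : Measure α) (q p : ℝ≥0∞) [Fact (1 ≤ q)] [Fact (1 ≤ p)]
    [q.HolderConjugate p] : Lp ℂ q μ →L[ℂ] Lp ℂ p μ →L[ℂ] ℂ :=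
  (ContinuousLinearMap.mul ℂ ℂ).lpPairing μ q p

lemma lpMulPairing_apply [Fact (1 ≤ q)] [Fact (1 ≤ p)] [q.HolderConjugate p]
    (g : Lp ℂ q μ) (f : Lp ℂ p μ) : lpMulPairing μ q p g f = ∫ x, g x * f x ∂μ := by
  simp [lpMulPairing, ContinuousLinearMap.lpPairing_eq_integral]

lemma lpMulPairing_indicatorConstLp [Fact (1 ≤ q)] [Fact (1 ≤ p)] [q.HolderConjugate p]
    (g : Lp ℂ q μ) {A : Set α} (hA : MeasurableSet A) (hμA : μ A ≠ ⊤) :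
    lpMulPairing μ q p g (indicatorConstLp p hA hμA 1) = ∫ x in A, g x ∂μ := by
  rw [lpMulPairing_apply, ← integral_indicator hA]
  refine integral_congr_ae ?_
  filter_upwards [indicatorConstLp_coeFn (p := p) (hs := hA) (hμs := hμA) (c := (1 : ℂ))] with x hx
  rw [hx]
  by_cases h : x ∈ A <;> simp [h]

lemma dual_ext_indicator [Fact (1 ≤ p)] (hp : p ≠ ⊤) {φ ψ : Lp ℂ p μ →L[ℂ] ℂ}
    (h : ∀ (A : Set α) (hA : MeasurableSet A) (hμA : μ A ≠ ⊤),
      φ (indicatorConstLp p hA hμA 1) = ψ (indicatorConstLp p hA hμA 1)) : φ = ψ := by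
  ext f
  induction f using Lp.induction hp with
  | @indicatorConst c s hs hμs =>
    have : indicatorConstLp p hs hμs.ne c = c • indicatorConstLp p hs hμs.ne (1 : ℂ) := by
      rw [indicatorConstLp, indicatorConstLp, ← MemLp.toLp_const_smul]
      congr 1
      ext x
      by_cases hx : x ∈ s <;> simp [hx]
    rw [Lp.simpleFunc.coe_indicatorConst, this, map_smul, map_smul, h]
  | add hf hg _ h1 h2 => rw [map_add, map_add, h1, h2]
  | isClosed => exact isClosed_eq φ.continuous ψ.continuous

/-- The converse Hölder inequality: `L^q` embeds isometrically in the dual of `L^p`. -/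
lemma norm_le_norm_lpMulPairing [Fact (1 ≤ q)] [Fact (1 ≤ p)] [q.HolderConjugate p]
    (hp : p ≠ ⊤) (hq : 1 < q) (hq' : q ≠ ⊤) (g : Lp ℂ q μ) :
    ‖g‖ ≤ ‖lpMulPairing μ q p g‖ := by
  set a := q.toReal with ha
  have ha1 : 1 < a := by
    rw [ha, ← ENNReal.toReal_one]
    exact (ENNReal.toReal_lt_toReal ENNReal.one_ne_top hq').2 hq
  have hconj : a.HolderConjugate p.toReal := ENNReal.HolderConjugate.toReal ha1
  have hpq : p * ENNReal.ofReal (a - 1) = q := by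
    rw [← ENNReal.ofReal_toReal hp, ← ENNReal.ofReal_toReal hq',
      ← ENNReal.ofReal_mul ENNReal.toReal_nonneg, mul_comm, hconj.sub_one_mul_conj]
  let f : α → ℂ := fun x => starRingEnd ℂ (g x) * ((‖g x‖ ^ (a - 2) : ℝ) : ℂ)
  have hfn : ∀ x, ‖f x‖ = ‖g x‖ ^ (a - 1) := by
    intro x
    rcases eq_or_ne (g x) 0 with h0 | h0
    · simp [f, h0, Real.zero_rpow (sub_pos.2 ha1).ne']
    · simp only [f, norm_mul, RCLike.norm_conj, Complex.norm_real, Real.norm_eq_abs]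
      rw [abs_of_nonneg (by positivity), ← Real.rpow_one_add' (norm_nonneg _) (by linarith)]
      ring_nf
  have hfmul : ∀ x, g x * f x = ((‖g x‖ ^ a : ℝ) : ℂ) := by
    intro x
    simp only [f]
    rw [← mul_assoc, Complex.mul_conj, Complex.normSq_eq_norm_sq, ← Complex.ofReal_mul,
      ← Real.rpow_natCast, ← Real.rpow_add' (norm_nonneg _) (by norm_num; linarith)]
    norm_num
  have hgm := (Lp.stronglyMeasurable g).measurable
  have hfm : Measurable f := by fun_prop
  have hfL : eLpNorm f p μ = eLpNorm g q μ ^ (a - 1) := by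
    have h1 := eLpNorm_norm_rpow (p := p) (μ := μ) g (sub_pos.2 ha1)
    rw [hpq] at h1
    rw [← h1, ← eLpNorm_norm f]
    simp only [hfn]
  have hf : MemLp f p μ := ⟨hfm.aestronglyMeasurable, by
    rw [hfL]
    exact ENNReal.rpow_lt_top_of_nonneg (sub_pos.2 ha1).le (Lp.eLpNorm_ne_top g)⟩
  have hnorm : ‖hf.toLp f‖ = ‖g‖ ^ (a - 1) := by
    rw [Lp.norm_toLp, hfL, ← ENNReal.toReal_rpow, Lp.norm_def]
  have hI : 0 ≤ ∫ x, ‖g x‖ ^ a ∂μ := integral_nonneg fun x => by positivity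
  have hpair : lpMulPairing μ q p g (hf.toLp f) = ((‖g‖ ^ a : ℝ) : ℂ) := by
    rw [lpMulPairing_apply, Lp.norm_def,
      (Lp.memLp g).eLpNorm_eq_integral_rpow_norm (zero_lt_one.trans hq).ne' hq',
      ENNReal.toReal_ofReal (by positivity), ← Real.rpow_mul hI,
      inv_mul_cancel₀ (by linarith), Real.rpow_one, ← integral_complex_ofReal]
    refine integral_congr_ae ?_
    filter_upwards [hf.coeFn_toLp] with x hx
    rw [hx, hfmul]
  rcases eq_or_ne g 0 with rfl | hg0
  · simp
  have hpos : 0 < ‖g‖ := norm_pos_iff.2 hg0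
  have hle := (lpMulPairing μ q p g).le_opNorm (hf.toLp f)
  rw [hpair, hnorm, Complex.norm_real, Real.norm_eq_abs, abs_of_nonneg (by positivity)] at hle
  have hsplit : ‖g‖ ^ a = ‖g‖ * ‖g‖ ^ (a - 1) := by
    rw [← Real.rpow_one_add' hpos.le (by linarith)]
    ring_nf
  rw [hsplit] at hle
  exact le_of_mul_le_mul_right hle (by positivity)

/-- Every continuous linear functional on `L^p`, `1 ≤ p < ∞`, is represented by an element of
`L^q`. -/
lemma lpMulPairing_surjective [SigmaFinite μ] [Fact (1 ≤ q)] [Fact (1 ≤ p)] [q.HolderConjugate p]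
    (hp : p ≠ ⊤) (hq : 1 < q) (hq' : q ≠ ⊤) :
    Function.Surjective (lpMulPairing μ q p) := by
  intro φ
  obtain ⟨h, hm, hφ⟩ := exists_measurable_eq_dual_indicator hp φ
  have hidx := measurableSet_spanningSetsIndex μ
  let U : ℕ → Set α := fun n => {x | spanningSetsIndex μ x < n}
  have hU : ∀ n, MeasurableSet (U n) := fun n => measurableSet_lt hidx measurable_const
  have hμU : ∀ n, μ (U n) ≠ ⊤ := fun n => ne_top_of_le_ne_top
    (measure_spanningSets_lt_top μ n).ne
    (measure_mono fun x hx => mem_spanningSets_of_index_le μ x (le_of_lt hx))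
  let E : ℕ → Set α := fun n => U n ∩ {x | ‖h x‖ ≤ n}
  have hE : ∀ n, MeasurableSet (E n) := fun n =>
    (hU n).inter (measurableSet_le hm.norm measurable_const)
  have hμE : ∀ n, μ (E n) ≠ ⊤ := fun n =>
    ne_top_of_le_ne_top (hμU n) (measure_mono Set.inter_subset_left)
  have hmem : ∀ n, MemLp ((E n).indicator h) q μ := fun n => by
    rw [memLp_indicator_iff_restrict (hE n)]
    have : IsFiniteMeasure (μ.restrict (E n)) := isFiniteMeasure_restrict.2 (hμE n)
    refine MemLp.of_bound hm.aestronglyMeasurable n ?_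
    filter_upwards [ae_restrict_mem (hE n)] with x hx using hx.2
  have hbound : ∀ n, eLpNorm ((E n).indicator h) q μ ≤ ENNReal.ofReal ‖φ‖ := fun n => by
    let χ : Lp ℂ ∞ μ := indicatorConstLp ∞ (hE n) (hμE n) 1
    let M : Lp ℂ p μ →L[ℂ] Lp ℂ p μ := (ContinuousLinearMap.mul ℂ ℂ).holderL μ ∞ p p χ
    have hMn : ∀ f, ‖M f‖ ≤ 1 * ‖f‖ := fun f => by
      refine ((ContinuousLinearMap.mul ℂ ℂ).norm_holder_apply_apply_le χ f).trans ?_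
      have h1 : ‖χ‖ ≤ 1 := by
        simpa using norm_indicatorConstLp_le (p := ∞) (hs := hE n) (hμs := hμE n) (c := (1 : ℂ))
      have h2 : ‖ContinuousLinearMap.mul ℂ ℂ‖ ≤ 1 := ContinuousLinearMap.opNorm_mul_le ℂ ℂ
      gcongr
      exact mul_le_one₀ h2 (norm_nonneg _) h1
    have hMA : ∀ (A : Set α) (hA : MeasurableSet A) (hμA : μ A ≠ ⊤),
        M (indicatorConstLp p hA hμA 1) = indicatorConstLp p (hA.inter (hE n))
          (ne_top_of_le_ne_top hμA (measure_mono Set.inter_subset_left)) 1 := by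
      intro A hA hμA
      refine Lp.ext ?_
      refine ((ContinuousLinearMap.mul ℂ ℂ).coeFn_holder (r := p) χ _).trans ?_
      refine .trans ?_ indicatorConstLp_coeFn.symm
      filter_upwards [indicatorConstLp_coeFn (p := p) (hs := hA) (hμs := hμA) (c := (1 : ℂ)),
        indicatorConstLp_coeFn (p := ∞) (hs := hE n) (hμs := hμE n) (c := (1 : ℂ))] with x h1 h2
      rw [h1, h2]
      by_cases hxA : x ∈ A <;> by_cases hxE : x ∈ E n <;> simp [hxA, hxE]
    have heq : lpMulPairing μ q p ((hmem n).toLp _) = φ.comp M := by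
      refine dual_ext_indicator hp fun A hA hμA => ?_
      rw [lpMulPairing_indicatorConstLp, ContinuousLinearMap.comp_apply, hMA,
        (hφ n _ _ _ (Set.inter_subset_right.trans Set.inter_subset_left)).2,
        ← setIntegral_indicator (hE n)]
      exact setIntegral_congr_ae hA ((hmem n).coeFn_toLp.mono fun x hx _ => hx)
    have hle := norm_le_norm_lpMulPairing (p := p) hp hq hq' ((hmem n).toLp _)
    rw [heq, Lp.norm_toLp] at hle
    have hM : ‖M‖ ≤ 1 := M.opNorm_le_bound zero_le_one hMn
    refine (ENNReal.le_ofReal_iff_toReal_le (hmem n).eLpNorm_ne_top (norm_nonneg _)).2 ?_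
    refine hle.trans ((φ.opNorm_comp_le M).trans ?_)
    simpa using mul_le_mul_of_nonneg_left hM (norm_nonneg φ)
  have hhq : MemLp h q μ := by
    refine ⟨hm.aestronglyMeasurable, lt_of_le_of_lt ?_ (ENNReal.ofReal_lt_top (r := ‖φ‖))⟩
    refine (Lp.eLpNorm_lim_le_liminf_eLpNorm
      (fun n => (hmem n).aestronglyMeasurable) h (ae_of_all _ fun x => ?_)).trans
      (liminf_le_of_le (by isBoundedDefault) fun b hb => ?_)
    · refine tendsto_const_nhds.congr' ?_
      filter_upwards [eventually_gt_atTop (spanningSetsIndex μ x),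
        eventually_ge_atTop ⌈‖h x‖⌉₊] with n h1 h2
      rw [Set.indicator_of_mem]
      exact ⟨h1, Nat.ceil_le.1 h2⟩
    · obtain ⟨n, hn⟩ := hb.exists
      exact hn.trans (hbound n)
  refine ⟨hhq.toLp h, dual_ext_indicator hp fun A hA hμA => ?_⟩
  have hAU : ⋃ n, A ∩ U n = A := by
    rw [← Set.inter_iUnion, Set.inter_eq_left]
    intro x _
    exact Set.mem_iUnion.2 ⟨spanningSetsIndex μ x + 1, Nat.lt_succ_self _⟩
  have hmono : Monotone fun n => A ∩ U n := fun m n hmn =>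
    Set.inter_subset_inter_right _ fun x hx => lt_of_lt_of_le hx hmn
  have hAUm : ∀ n, MeasurableSet (A ∩ U n) := fun n => hA.inter (hU n)
  have hμAU : ∀ n, μ (A ∩ U n) ≠ ⊤ := fun n =>
    ne_top_of_le_ne_top hμA (measure_mono Set.inter_subset_left)
  have hint : IntegrableOn h A μ := by
    have : IsFiniteMeasure (μ.restrict A) := isFiniteMeasure_restrict.2 hμA
    exact (hhq.restrict A).integrable hq.le
  have hlim1 : Tendsto (fun n => ∫ x in A ∩ U n, h x ∂μ) atTop (𝓝 (∫ x in A, h x ∂μ)) := by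
    have := tendsto_setIntegral_of_monotone hAUm hmono (f := h) (μ := μ) (by rwa [hAU])
    rwa [hAU] at this
  have hlim2 : Tendsto (fun n => φ (indicatorConstLp p (hAUm n) (hμAU n) 1)) atTop
      (𝓝 (φ (indicatorConstLp p hA hμA 1))) := by
    refine (φ.continuous.tendsto _).comp (tendsto_indicatorConstLp_set hp ?_)
    have h1 := tendsto_measure_iInter_atTop (μ := μ) (s := fun n => A \ U n)
      (fun n => (hA.diff (hU n)).nullMeasurableSet)
      (fun m n hmn => Set.sdiff_subset_sdiff_right fun x hx => lt_of_lt_of_le hx hmn)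
      ⟨0, ne_top_of_le_ne_top hμA (measure_mono Set.sdiff_subset)⟩
    have h2 : ⋂ n, A \ U n = ∅ := by
      rw [← Set.sdiff_iUnion, Set.sdiff_eq_empty]
      intro x _
      exact Set.mem_iUnion.2 ⟨spanningSetsIndex μ x + 1, Nat.lt_succ_self _⟩
    rw [h2, measure_empty] at h1
    refine h1.congr fun n => ?_
    simp only [Function.comp_apply]
    congr 1
    ext x
    simp only [Set.mem_symmDiff, Set.mem_inter_iff, Set.mem_sdiff]
    tauto
  rw [lpMulPairing_indicatorConstLp,
    setIntegral_congr_ae hA (hhq.coeFn_toLp.mono fun x hx _ => hx)]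
  refine tendsto_nhds_unique hlim1 (hlim2.congr fun n => ?_)
  exact (hφ n _ _ _ Set.inter_subset_right).2

/-- The transpose of an operator on `L^p`, acting on `L^q`. -/
lemma exists_lp_transpose [SigmaFinite μ] [Fact (1 ≤ q)] [Fact (1 ≤ p)] [q.HolderConjugate p]
    (hp : p ≠ ⊤) (hq : 1 < q) (hq' : q ≠ ⊤) (T : Lp ℂ p μ →L[ℂ] Lp ℂ p μ) :
    ∃ S : Lp ℂ q μ →L[ℂ] Lp ℂ q μ, ∀ (g : Lp ℂ q μ) (f : Lp ℂ p μ),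
      ∫ x, S g x * f x ∂μ = ∫ x, g x * T f x ∂μ := by
  let J := ContinuousLinearEquiv.ofBijective (lpMulPairing μ q p)
    (LinearMap.ker_eq_bot'.2 fun g hg => by
      have := norm_le_norm_lpMulPairing (p := p) hp hq hq' g
      have hg' : lpMulPairing μ q p g = 0 := hg
      rw [hg', norm_zero] at this
      exact norm_le_zero_iff.1 this)
    (LinearMap.range_eq_top.2 (lpMulPairing_surjective hp hq hq'))
  refine ⟨(J.symm : (Lp ℂ p μ →L[ℂ] ℂ) →L[ℂ] Lp ℂ q μ).comp
    (((ContinuousLinearMap.compL ℂ (Lp ℂ p μ) (Lp ℂ p μ) ℂ).flip T).comp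
      (lpMulPairing μ q p)), fun g f => ?_⟩
  rw [← lpMulPairing_apply, ← lpMulPairing_apply]
  have h := J.apply_symm_apply ((lpMulPairing μ q p g).comp T)
  exact congrArg (fun ψ : Lp ℂ p μ →L[ℂ] ℂ => ψ f) h

end LpDual

/-- `G^p` is a right ideal of `B(L^p(ℝ))`: for every kernel
`k ∈ L^p(ℝ;L^q(ℝ))` and every bounded operator `T` on `L^p(ℝ)` there is a kernel `k'` with
`(Int k) ∘ T = Int k'`. -/
theorem Gp_right_ideal
    (p q : ℝ≥0∞) [Fact (1 ≤ p)] [Fact (1 ≤ q)]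
    (hp : 1 < p) (hp' : p ≠ ⊤) (hq : 1 < q) (hq' : q ≠ ⊤)
    (hpq : 1 / p + 1 / q = 1)
    (k : LpLq p q) (Ik T : LpR p →L[ℂ] LpR p) (hIk : IsIntOp p q k Ik) :
    ∃ k' : LpLq p q, IsIntOp p q k' (Ik.comp T) := by
  have : q.HolderConjugate p := ENNReal.holderConjugate_iff.2 (by
    rw [add_comm]
    simpa using hpq)
  obtain ⟨S, hS⟩ := exists_lp_transpose (q := q) hp' hq hq' T
  refine ⟨S.compLp k, fun f => ?_⟩
  filter_upwards [hIk (T f), S.coeFn_compLp k] with x h1 h2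
  rw [ContinuousLinearMap.comp_apply, h1, h2, hS]

end
end

section
/- Let p ∈ (1,∞) and let J be the flip operator on L^p(ℝ), (Jf)(x) = f(−x). The Fourier binest algebra is antisymmetric: if T ∈ A_FB^p and JTJ ∈ A_FB^p, then T is a scalar multiple of the identity. That is, A_FB^p ∩ J A_FB^p J = ℂ·I. -/
open MeasureTheory Complex Filter Topology
open scoped ENNReal NNReal

noncomputable section

/-- `h` multiplies into `T`: whenever `g = h f` in `L^p`, also `T g = h (T f)`. -/
def CommutesWithMul {p : ℝ≥0∞} [Fact (1 ≤ p)] (T : LpR p →L[ℂ] LpR p) (h : ℝ → ℂ) : Prop :=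
  ∀ f g : LpR p, (g : ℝ → ℂ) =ᵐ[volume] (fun x => h x * (f : ℝ → ℂ) x) →
    (T g : ℝ → ℂ) =ᵐ[volume] fun x => h x * (T f : ℝ → ℂ) x

lemma exists_lp_eq_mul {p : ℝ≥0∞} {h : ℝ → ℂ} (hm : Measurable h) {C : ℝ}
    (hC : ∀ x, ‖h x‖ ≤ C) (f : LpR p) :
    ∃ g : LpR p, (g : ℝ → ℂ) =ᵐ[volume] fun x => h x * (f : ℝ → ℂ) x := by
  have hmem : MemLp (fun x => h x * (f : ℝ → ℂ) x) p volume := by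
    refine (Lp.memLp f).of_le_mul (c := C)
      (hm.aestronglyMeasurable.mul (Lp.aestronglyMeasurable f)) (Eventually.of_forall fun x => ?_)
    rw [norm_mul]
    exact mul_le_mul_of_nonneg_right (hC x) (norm_nonneg _)
  exact ⟨hmem.toLp _, hmem.coeFn_toLp⟩

lemma tendsto_lp_of_bounded_mul {p : ℝ≥0∞} [Fact (1 ≤ p)] (hp : p ≠ ⊤) {H : ℕ → ℝ → ℂ}
    {h : ℝ → ℂ} {C : ℝ} (hC : ∀ n x, ‖H n x‖ ≤ C)
    (hlim : ∀ x, Tendsto (fun n => H n x) atTop (𝓝 (h x))) {f g : LpR p} {G : ℕ → LpR p}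
    (hG : ∀ n, (G n : ℝ → ℂ) =ᵐ[volume] fun x => H n x * (f : ℝ → ℂ) x)
    (hg : (g : ℝ → ℂ) =ᵐ[volume] fun x => h x * (f : ℝ → ℂ) x) :
    Tendsto G atTop (𝓝 g) := by
  have hp0 : p ≠ 0 := (zero_lt_one.trans_le (Fact.out : 1 ≤ p)).ne'
  have hpp : 0 < p.toReal := ENNReal.toReal_pos hp0 hp
  rw [Lp.tendsto_Lp_iff_tendsto_eLpNorm']
  simp only [eLpNorm_eq_lintegral_rpow_enorm_toReal hp0 hp]
  have key : Tendsto (fun n => ∫⁻ x, ‖((G n : ℝ → ℂ) - (g : ℝ → ℂ)) x‖ₑ ^ p.toReal) atTop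
      (𝓝 (∫⁻ _ : ℝ, 0)) := by
    have hlim' : ∀ x, ‖h x‖ ≤ C := fun x =>
      le_of_tendsto (hlim x).norm (Eventually.of_forall fun n => hC n x)
    refine tendsto_lintegral_of_dominated_convergence'
      (fun x => ‖((2 * C : ℝ) : ℂ) * (f : ℝ → ℂ) x‖ₑ ^ p.toReal) ?_ ?_ ?_ ?_
    · intro n
      exact (((Lp.aestronglyMeasurable (G n)).sub (Lp.aestronglyMeasurable g)).enorm).pow_const _
    · intro n
      filter_upwards [hG n, hg] with x hx hx'
      refine ENNReal.rpow_le_rpow ?_ hpp.le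
      rw [Pi.sub_apply, hx, hx', ← sub_mul, enorm_mul, enorm_mul]
      gcongr
      rw [enorm_le_iff_norm_le]
      have hC0 : 0 ≤ C := (norm_nonneg _).trans (hC n x)
      calc ‖H n x - h x‖ ≤ ‖H n x‖ + ‖h x‖ := norm_sub_le _ _
        _ ≤ 2 * C := by linarith [hC n x, hlim' x]
        _ = ‖((2 * C : ℝ) : ℂ)‖ := by rw [Complex.norm_real, Real.norm_of_nonneg (by linarith)]
    · exact (lintegral_rpow_enorm_lt_top_of_eLpNorm_lt_top hp0 hp
        ((Lp.memLp f).const_mul _).2).ne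
    · filter_upwards [ae_all_iff.2 hG, hg] with x hx hx'
      simp only [Pi.sub_apply, hx, hx', ← sub_mul]
      have h1 : Tendsto (fun n => (H n x - h x) * (f : ℝ → ℂ) x) atTop (𝓝 0) := by
        simpa using ((hlim x).sub_const (h x)).mul_const ((f : ℝ → ℂ) x)
      have h2 := (ENNReal.continuous_rpow_const (y := p.toReal)).tendsto _ |>.comp h1.enorm
      simpa [ENNReal.zero_rpow_of_pos hpp, Function.comp_def] using h2
  simp only [lintegral_zero] at key
  have h2 := (ENNReal.continuous_rpow_const (y := 1 / p.toReal)).tendsto _ |>.comp key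
  simpa [ENNReal.zero_rpow_of_pos (inv_pos.2 hpp), Function.comp_def] using h2

section CommutesWithMul

variable {p : ℝ≥0∞} [Fact (1 ≤ p)] {T : LpR p →L[ℂ] LpR p}

lemma CommutesWithMul.of_tendsto (hp : p ≠ ⊤) {H : ℕ → ℝ → ℂ} (hm : ∀ n, Measurable (H n))
    {h : ℝ → ℂ} {C : ℝ} (hC : ∀ n x, ‖H n x‖ ≤ C)
    (hlim : ∀ x, Tendsto (fun n => H n x) atTop (𝓝 (h x))) (hT : ∀ n, CommutesWithMul T (H n)) :
    CommutesWithMul T h := by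
  intro f g hg
  choose G hG using fun n => exists_lp_eq_mul (hm n) (hC n) f
  obtain ⟨k, hk⟩ := exists_lp_eq_mul (measurable_of_tendsto_metrizable hm (tendsto_pi_nhds.2 hlim))
    (fun x => le_of_tendsto (hlim x).norm (Eventually.of_forall fun n => hC n x)) (T f)
  have h1 : Tendsto (fun n => T (G n)) atTop (𝓝 (T g)) :=
    (T.continuous.tendsto g).comp (tendsto_lp_of_bounded_mul hp hC hlim hG hg)
  have h2 : Tendsto (fun n => T (G n)) atTop (𝓝 k) :=
    tendsto_lp_of_bounded_mul hp hC hlim (fun n => hT n f _ (hG n)) hk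
  rw [tendsto_nhds_unique h1 h2]
  exact hk

lemma CommutesWithMul.add {h k : ℝ → ℂ} (hm : Measurable h) {C : ℝ} (hC : ∀ x, ‖h x‖ ≤ C)
    (hh : CommutesWithMul T h) (hk : CommutesWithMul T k) :
    CommutesWithMul T (fun x => h x + k x) := by
  intro f g hg
  obtain ⟨a, ha⟩ := exists_lp_eq_mul hm hC f
  have hb : ((g - a : LpR p) : ℝ → ℂ) =ᵐ[volume] fun x => k x * (f : ℝ → ℂ) x := by
    filter_upwards [Lp.coeFn_sub g a, hg, ha] with x h1 h2 h3
    rw [h1, Pi.sub_apply, h2, h3]; ring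
  have hg' : T g = T a + T (g - a) := by rw [← map_add]; congr 1; abel
  rw [hg']
  filter_upwards [Lp.coeFn_add (T a) (T (g - a)), hh f a ha, hk f _ hb] with x h1 h2 h3
  rw [h1, Pi.add_apply, h2, h3]; ring

lemma CommutesWithMul.const_mul {h : ℝ → ℂ} (hm : Measurable h) {C : ℝ} (hC : ∀ x, ‖h x‖ ≤ C)
    (hh : CommutesWithMul T h) (c : ℂ) : CommutesWithMul T (fun x => c * h x) := by
  intro f g hg
  obtain ⟨a, ha⟩ := exists_lp_eq_mul hm hC f
  have hga : g = c • a := by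
    refine Lp.ext ?_
    filter_upwards [Lp.coeFn_smul c a, hg, ha] with x h1 h2 h3
    rw [h1, Pi.smul_apply, h2, h3, smul_eq_mul, mul_assoc]
  rw [hga, map_smul]
  filter_upwards [Lp.coeFn_smul c (T a), hh f a ha] with x h1 h2
  rw [h1, Pi.smul_apply, h2, smul_eq_mul, mul_assoc]

lemma commutesWithMul_one : CommutesWithMul T (fun _ => 1) := by
  intro f g hg
  have : g = f := Lp.ext (hg.trans (by simp))
  simp [this]

lemma norm_indicator_one_le (s : Set ℝ) (x : ℝ) : ‖s.indicator (fun _ => (1 : ℂ)) x‖ ≤ 1 := by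
  by_cases hx : x ∈ s <;> simp [hx]

lemma measurable_indicator_one {s : Set ℝ} (hs : MeasurableSet s) :
    Measurable (s.indicator (fun _ => (1 : ℂ))) := measurable_const.indicator hs

lemma CommutesWithMul.indicator_union {s t : Set ℝ} (hs : MeasurableSet s) (hst : Disjoint s t)
    (h₁ : CommutesWithMul T (s.indicator fun _ => 1))
    (h₂ : CommutesWithMul T (t.indicator fun _ => 1)) :
    CommutesWithMul T ((s ∪ t).indicator fun _ => 1) := by
  rw [Set.indicator_union_of_disjoint hst]
  exact h₁.add (measurable_indicator_one hs) (norm_indicator_one_le s) h₂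

lemma CommutesWithMul.indicator_of_Ici (hp : p ≠ ⊤)
    (hT : ∀ t : ℝ, CommutesWithMul T ((Set.Ici t).indicator fun _ => 1)) {s : Set ℝ}
    (hs : MeasurableSet s) : CommutesWithMul T (s.indicator fun _ => 1) := by
  have hz : CommutesWithMul T ((∅ : Set ℝ).indicator fun _ => 1) := by
    have := commutesWithMul_one.const_mul (T := T) measurable_const (C := 1) (by simp) 0
    simpa using this
  refine MeasurableSpace.induction_on_inter
    (C := fun s _ => CommutesWithMul T (s.indicator fun _ => 1))
    ((BorelSpace.measurable_eq (α := ℝ)).trans (borel_eq_generateFrom_Ici ℝ)) isPiSystem_Ici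
    hz ?_ ?_ ?_ s hs
  · rintro _ ⟨t, rfl⟩
    exact hT t
  · intro t htm ht
    have h1 := (ht.const_mul (measurable_indicator_one htm) (norm_indicator_one_le t) (-1)).add
      ((measurable_indicator_one htm).const_mul _) (C := 1)
      (by simpa using norm_indicator_one_le t) commutesWithMul_one
    convert h1 using 1
    ext x
    by_cases hx : x ∈ t <;> simp [hx]
  · intro F hF hFm hFT
    have hfin : ∀ n : ℕ, CommutesWithMul T ((⋃ i ∈ Finset.range n, F i).indicator fun _ => 1) := by
      intro n
      induction n with
      | zero => simpa using hz
      | succ n ih =>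
        rw [Finset.range_add_one, Finset.set_biUnion_insert]
        refine (hFT n).indicator_union (hFm n) ?_ ih
        simp only [Set.disjoint_iUnion_right, Finset.mem_range]
        exact fun i hi => hF hi.ne'
    refine CommutesWithMul.of_tendsto hp (fun n => measurable_indicator_one
      (Finset.measurableSet_biUnion _ fun i _ => hFm i)) (fun n => norm_indicator_one_le _)
      (fun x => ?_) hfin
    exact ((tendsto_indicator_biUnion_finset F (fun _ => (1 : ℂ)) x).comp
      tendsto_finset_range).mono_right (pure_le_nhds _)

lemma CommutesWithMul.of_bounded (hp : p ≠ ⊤)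
    (hT : ∀ t : ℝ, CommutesWithMul T ((Set.Ici t).indicator fun _ => 1)) {h : ℝ → ℂ}
    (hm : Measurable h) {C : ℝ} (hC : ∀ x, ‖h x‖ ≤ C) : CommutesWithMul T h := by
  have hC0 : 0 ≤ C := (norm_nonneg _).trans (hC 0)
  have hsimple : ∀ φ : SimpleFunc ℝ ℂ, CommutesWithMul T φ := by
    intro φ
    induction φ using SimpleFunc.induction with
    | @const c s hs =>
      convert (CommutesWithMul.indicator_of_Ici hp hT hs).const_mul (measurable_indicator_one hs)
        (norm_indicator_one_le _) c using 1
      ext x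
      by_cases hx : x ∈ s <;> simp [Set.piecewise, hx]
    | @add f g _ hf hg =>
      obtain ⟨M, hM⟩ := f.exists_forall_norm_le
      exact hf.add f.measurable hM hg
  exact CommutesWithMul.of_tendsto hp (fun n => SimpleFunc.measurable _)
    (fun n x => hm.stronglyMeasurable.norm_approxBounded_le hC0 n x)
    (fun x => hm.stronglyMeasurable.tendsto_approxBounded_of_norm_le (hC x)) (fun n => hsimple _)

end CommutesWithMul

lemma one_add_sq_mul_poisson_le {y : ℝ} (hy : 0 < y) (hy1 : y ≤ 1) (x s : ℝ) :
    (1 + x ^ 2) * (y / ((x - s) ^ 2 + y ^ 2)) ≤ (2 + 2 * s ^ 2) / y := by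
  have hd : 0 < (x - s) ^ 2 + y ^ 2 := by positivity
  rw [mul_div_assoc', div_le_div_iff₀ hd hy]
  have h1 : x ^ 2 ≤ 2 * (x - s) ^ 2 + 2 * s ^ 2 := by nlinarith [sq_nonneg (x - 2 * s)]
  have h2 : y ^ 2 ≤ 1 := by nlinarith
  nlinarith [mul_nonneg (sq_nonneg s) (sq_nonneg (x - s)), mul_nonneg (sq_nonneg s) (sq_nonneg y),
    mul_le_mul_of_nonneg_right h1 (sq_nonneg y),
    mul_le_mul_of_nonneg_right h2 (sq_nonneg (x - s)), sq_nonneg (x - s), sq_nonneg y]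

lemma integral_poisson_mul (g : ℝ → ℝ) (x : ℝ) {y : ℝ} (hy : 0 < y) :
    ∫ s, g s * (y / ((x - s) ^ 2 + y ^ 2)) = ∫ t, g (x + y * t) * (1 + t ^ 2)⁻¹ := by
  have h1 := Measure.integral_comp_mul_left
    (fun r => g (x + r) * (y / ((x - (x + r)) ^ 2 + y ^ 2))) y
  have h2 := integral_add_left_eq_self (μ := volume)
    (fun s => g s * (y / ((x - s) ^ 2 + y ^ 2))) x
  rw [h2, abs_of_pos (inv_pos.2 hy), smul_eq_mul] at h1
  rw [← mul_right_inj' (inv_pos.2 hy).ne', ← h1, ← integral_const_mul]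
  congr 1
  ext t
  have : (x - (x + y * t)) ^ 2 + y ^ 2 = y ^ 2 * (1 + t ^ 2) := by ring
  rw [this]
  have : (1 + t ^ 2) ≠ 0 := by positivity
  field_simp

lemma integral_poisson (x : ℝ) {y : ℝ} (hy : 0 < y) :
    ∫ s, y / ((x - s) ^ 2 + y ^ 2) = Real.pi := by
  have := integral_poisson_mul (fun _ => 1) x hy
  simpa [integral_univ_inv_one_add_sq] using this

lemma abs_integral_mul_inv_one_add_sq_le {g : ℝ → ℝ} {M : ℝ} (hM : ∀ t, |g t| ≤ M) :
    |∫ t, g t * (1 + t ^ 2)⁻¹| ≤ M * Real.pi := by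
  have := norm_integral_le_of_norm_le (f := fun t : ℝ => g t * (1 + t ^ 2)⁻¹)
    (g := fun t => M * (1 + t ^ 2)⁻¹)
    (integrable_inv_one_add_sq.const_mul M) (Eventually.of_forall fun t => by
      rw [norm_mul, Real.norm_of_nonneg (r := (1 + t ^ 2)⁻¹) (by positivity)]
      exact mul_le_mul_of_nonneg_right (hM t) (by positivity))
  rwa [integral_const_mul, integral_univ_inv_one_add_sq] at this

lemma integrable_mul_poisson {g : ℝ → ℝ} (hg : Continuous g) (hgs : HasCompactSupport g) (x : ℝ)
    {y : ℝ} (hy : 0 < y) : Integrable fun s => g s * (y / ((x - s) ^ 2 + y ^ 2)) := by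
  refine Continuous.integrable_of_hasCompactSupport ?_ hgs.mul_right
  have : ∀ s, (x - s) ^ 2 + y ^ 2 ≠ 0 := fun s => by positivity
  fun_prop (disch := assumption)

lemma exists_bound_poisson {g : ℝ → ℝ} (hg : Continuous g) (hgs : HasCompactSupport g) :
    ∃ C : ℝ, ∀ x y : ℝ, 0 < y → y ≤ 1 →
      |(1 + x ^ 2) * ∫ s, g s * (y / ((x - s) ^ 2 + y ^ 2))| ≤ C := by
  have hGc : Continuous fun s => (1 + 2 * s ^ 2) * |g s| := by fun_prop
  have hgs' : HasCompactSupport fun s => |g s| := hgs.comp_left (g := fun r : ℝ => |r|) abs_zero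
  have hGs : HasCompactSupport fun s => (1 + 2 * s ^ 2) * |g s| := hgs'.mul_left
  have hgi : Integrable fun s => |g s| := hg.abs.integrable_of_hasCompactSupport hgs'
  obtain ⟨M, hM⟩ := hGs.exists_bound_of_continuous hGc
  refine ⟨M * Real.pi + 2 * ∫ s, |g s|, fun x y hy hy1 => ?_⟩
  have hi := integrable_mul_poisson hGc hGs x hy
  have hle : ‖∫ s, (1 + x ^ 2) * (g s * (y / ((x - s) ^ 2 + y ^ 2)))‖ ≤
      ∫ s, ((1 + 2 * s ^ 2) * |g s| * (y / ((x - s) ^ 2 + y ^ 2)) + 2 * |g s|) := by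
    refine norm_integral_le_of_norm_le (hi.add (hgi.const_mul 2)) (Eventually.of_forall fun s => ?_)
    have hd : 0 < (x - s) ^ 2 + y ^ 2 := by positivity
    have hk : (1 + x ^ 2) * (y / ((x - s) ^ 2 + y ^ 2)) ≤
        (1 + 2 * s ^ 2) * (y / ((x - s) ^ 2 + y ^ 2)) + 2 := by
      rw [mul_div_assoc', mul_div_assoc', div_add' _ _ _ hd.ne']
      gcongr
      have h1 : x ^ 2 ≤ 2 * (x - s) ^ 2 + 2 * s ^ 2 := by nlinarith [sq_nonneg (x - 2 * s)]
      nlinarith [mul_le_mul_of_nonneg_right h1 hy.le,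
        mul_le_mul_of_nonneg_right hy1 (sq_nonneg (x - s)), sq_nonneg y]
    calc ‖(1 + x ^ 2) * (g s * (y / ((x - s) ^ 2 + y ^ 2)))‖
        = |g s| * ((1 + x ^ 2) * (y / ((x - s) ^ 2 + y ^ 2))) := by
          rw [norm_mul, norm_mul, Real.norm_of_nonneg (r := 1 + x ^ 2) (by positivity),
            Real.norm_of_nonneg (r := y / _) (by positivity), Real.norm_eq_abs]
          ring
      _ ≤ |g s| * ((1 + 2 * s ^ 2) * (y / ((x - s) ^ 2 + y ^ 2)) + 2) := by gcongr
      _ = _ := by ring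
  rw [integral_const_mul, integral_add hi (hgi.const_mul 2), integral_const_mul,
    integral_poisson_mul (fun s => (1 + 2 * s ^ 2) * |g s|) x hy] at hle
  refine hle.trans (add_le_add_left ?_ _)
  exact (le_abs_self _).trans (abs_integral_mul_inv_one_add_sq_le fun t => hM _)

lemma tendsto_integral_poisson {g : ℝ → ℝ} (hg : Continuous g) (hgs : HasCompactSupport g)
    {y : ℕ → ℝ} (hy : ∀ n, 0 < y n) (hy0 : Tendsto y atTop (𝓝 0)) (x : ℝ) :
    Tendsto (fun n => ∫ s, g s * (y n / ((x - s) ^ 2 + y n ^ 2))) atTop (𝓝 (g x * Real.pi)) := by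
  simp only [integral_poisson_mul g x (hy _)]
  rw [← integral_univ_inv_one_add_sq, ← integral_const_mul]
  obtain ⟨M, hM⟩ := hgs.exists_bound_of_continuous hg
  refine tendsto_integral_of_dominated_convergence (fun t => M * (1 + t ^ 2)⁻¹) (fun n => ?_)
    (integrable_inv_one_add_sq.const_mul M) (fun n => Eventually.of_forall fun t => ?_)
    (Eventually.of_forall fun t => ?_)
  · exact ((hg.comp (by fun_prop)).aestronglyMeasurable.mul
      integrable_inv_one_add_sq.aestronglyMeasurable)
  · rw [norm_mul, Real.norm_of_nonneg (r := (1 + t ^ 2)⁻¹) (by positivity)]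
    exact mul_le_mul_of_nonneg_right (hM _) (by positivity)
  · refine Tendsto.mul_const _ ((hg.tendsto x).comp ?_)
    simpa using (hy0.mul_const t).const_add x

lemma one_add_ofReal_sq_ne_zero (x : ℝ) : (1 + (x : ℂ) ^ 2) ≠ 0 := by
  have : (1 + x ^ 2 : ℝ) ≠ 0 := by positivity
  exact_mod_cast this

lemma norm_one_add_ofReal_sq (x : ℝ) : ‖1 + (x : ℂ) ^ 2‖ = 1 + x ^ 2 := by
  have : (1 + (x : ℂ) ^ 2) = ((1 + x ^ 2 : ℝ) : ℂ) := by push_cast; ring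
  rw [this, Complex.norm_real, Real.norm_of_nonneg (by positivity)]

section PoissonUniqueness

variable {ψ : ℝ → ℂ}

lemma locallyIntegrable_of_div_one_add_sq (hψ : Integrable fun x => ψ x / (1 + (x : ℂ) ^ 2)) :
    LocallyIntegrable ψ volume := by
  have hc : ContinuousOn (fun x : ℝ => 1 + (x : ℂ) ^ 2) Set.univ := by fun_prop
  have := (locallyIntegrableOn_univ.2 hψ.locallyIntegrable).continuousOn_mul hc
    isClosed_univ.isLocallyClosed
  refine (locallyIntegrableOn_univ.1 this).congr (Eventually.of_forall fun x => ?_)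
  exact mul_div_cancel₀ _ (one_add_ofReal_sq_ne_zero x)

lemma norm_eq_one_add_sq_mul_norm_div (x : ℝ) :
    ‖ψ x‖ = (1 + x ^ 2) * ‖ψ x / (1 + (x : ℂ) ^ 2)‖ := by
  rw [norm_div, norm_one_add_ofReal_sq]
  field_simp

lemma integrable_prod_mul_poisson (hψ : Integrable fun x => ψ x / (1 + (x : ℂ) ^ 2)) {g : ℝ → ℝ}
    (hg : Continuous g) (hgs : HasCompactSupport g) {y : ℝ} (hy : 0 < y) (hy1 : y ≤ 1) :
    Integrable (Function.uncurry fun x s : ℝ =>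
      ψ x * ((g s * (y / ((x - s) ^ 2 + y ^ 2)) : ℝ) : ℂ)) (volume.prod volume) := by
  have hG : Integrable fun s => (2 + 2 * s ^ 2) / y * g s :=
    Continuous.integrable_of_hasCompactSupport (by fun_prop) hgs.mul_left
  refine (hψ.norm.mul_prod hG.norm).mono' ?_ (Eventually.of_forall fun z => ?_)
  · have hd : ∀ z : ℝ × ℝ, (z.1 - z.2) ^ 2 + y ^ 2 ≠ 0 := fun z => by positivity
    have hk : Continuous fun z : ℝ × ℝ => g z.2 * (y / ((z.1 - z.2) ^ 2 + y ^ 2)) := by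
      fun_prop (disch := assumption)
    exact (locallyIntegrable_of_div_one_add_sq hψ).aestronglyMeasurable.comp_fst.mul
      (Complex.continuous_ofReal.comp hk).aestronglyMeasurable
  · obtain ⟨x, s⟩ := z
    have hb := one_add_sq_mul_poisson_le hy hy1 x s
    have hk : 0 ≤ y / ((x - s) ^ 2 + y ^ 2) := by positivity
    have hk' : 0 ≤ (2 + 2 * s ^ 2) / y := by positivity
    simp only [Function.uncurry_apply_pair]
    rw [norm_mul, norm_eq_one_add_sq_mul_norm_div x, Complex.norm_real, norm_mul, norm_mul,
      Real.norm_of_nonneg hk, Real.norm_of_nonneg hk']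
    calc (1 + x ^ 2) * ‖ψ x / (1 + (x : ℂ) ^ 2)‖ * (‖g s‖ * (y / ((x - s) ^ 2 + y ^ 2)))
        = ‖ψ x / (1 + (x : ℂ) ^ 2)‖ *
          (((1 + x ^ 2) * (y / ((x - s) ^ 2 + y ^ 2))) * ‖g s‖) := by ring
      _ ≤ _ := by gcongr

lemma integral_mul_integral_poisson_eq_zero
    (hψ : Integrable fun x => ψ x / (1 + (x : ℂ) ^ 2)) {g : ℝ → ℝ}
    (hg : Continuous g) (hgs : HasCompactSupport g) {y : ℝ} (hy : 0 < y) (hy1 : y ≤ 1)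
    (h0 : ∀ s : ℝ, ∫ x, ψ x * ((y / ((x - s) ^ 2 + y ^ 2) : ℝ) : ℂ) = 0) :
    ∫ x, ψ x * ((∫ s, g s * (y / ((x - s) ^ 2 + y ^ 2)) : ℝ) : ℂ) = 0 := by
  have hswap := integral_integral_swap (integrable_prod_mul_poisson hψ hg hgs hy hy1)
  simp only [integral_const_mul] at hswap
  simp only [← integral_complex_ofReal]
  rw [hswap]
  refine integral_eq_zero_of_ae (Eventually.of_forall fun s => ?_)
  simp only [Complex.ofReal_mul, mul_left_comm (ψ _), integral_const_mul, h0 s, mul_zero,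
    Pi.zero_apply]

lemma tendsto_integral_mul_integral_poisson
    (hψ : Integrable fun x => ψ x / (1 + (x : ℂ) ^ 2)) {g : ℝ → ℝ}
    (hg : Continuous g) (hgs : HasCompactSupport g) {y : ℕ → ℝ} (hy : ∀ n, 0 < y n)
    (hy1 : ∀ n, y n ≤ 1) (hy0 : Tendsto y atTop (𝓝 0)) :
    Tendsto (fun n => ∫ x, ψ x * ((∫ s, g s * (y n / ((x - s) ^ 2 + y n ^ 2)) : ℝ) : ℂ)) atTop
      (𝓝 (∫ x, ψ x * ((g x * Real.pi : ℝ) : ℂ))) := by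
  obtain ⟨C, hC⟩ := exists_bound_poisson hg hgs
  refine tendsto_integral_of_dominated_convergence
    (fun x => C * ‖ψ x / (1 + (x : ℂ) ^ 2)‖) (fun n => ?_)
    (hψ.norm.const_mul C) (fun n => Eventually.of_forall fun x => ?_)
    (Eventually.of_forall fun x => ?_)
  · refine (locallyIntegrable_of_div_one_add_sq hψ).aestronglyMeasurable.mul
      (Complex.continuous_ofReal.comp_aestronglyMeasurable
        (StronglyMeasurable.aestronglyMeasurable ?_))
    have hd : ∀ z : ℝ × ℝ, (z.1 - z.2) ^ 2 + y n ^ 2 ≠ 0 := fun z => by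
      have := hy n; positivity
    have hk : Continuous fun z : ℝ × ℝ => g z.2 * (y n / ((z.1 - z.2) ^ 2 + y n ^ 2)) := by
      fun_prop (disch := assumption)
    exact hk.stronglyMeasurable.integral_prod_right'
  · have hb := hC x (y n) (hy n) (hy1 n)
    rw [abs_mul, abs_of_nonneg (by positivity : 0 ≤ 1 + x ^ 2)] at hb
    rw [norm_mul, norm_eq_one_add_sq_mul_norm_div x, Complex.norm_real, Real.norm_eq_abs,
      mul_right_comm]
    exact mul_le_mul_of_nonneg_right hb (norm_nonneg _)
  · exact Tendsto.const_mul _ ((Complex.continuous_ofReal.tendsto _).comp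
      (tendsto_integral_poisson hg hgs hy hy0 x))

/-- A function whose Poisson extension vanishes is zero almost everywhere. -/
lemma ae_eq_zero_of_integral_poisson_eq_zero
    (hψ : Integrable fun x => ψ x / (1 + (x : ℂ) ^ 2))
    (h0 : ∀ s y : ℝ, 0 < y → ∫ x, ψ x * ((y / ((x - s) ^ 2 + y ^ 2) : ℝ) : ℂ) = 0) :
    ∀ᵐ x, ψ x = 0 := by
  refine ae_eq_zero_of_integral_contDiff_smul_eq_zero (locallyIntegrable_of_div_one_add_sq hψ)
    fun g hgd hgs => ?_
  have hpos : ∀ n : ℕ, 0 < 1 / ((n : ℝ) + 1) := fun n => by positivity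
  have hle : ∀ n : ℕ, 1 / ((n : ℝ) + 1) ≤ 1 := fun n => by
    rw [div_le_one (by positivity)]; linarith [n.cast_nonneg (α := ℝ)]
  have hlim := tendsto_integral_mul_integral_poisson hψ hgd.continuous hgs hpos hle
    tendsto_one_div_add_atTop_nhds_zero_nat
  simp only [integral_mul_integral_poisson_eq_zero hψ hgd.continuous hgs (hpos _) (hle _)
    fun s => h0 s _ (hpos _)] at hlim
  have hfin := tendsto_nhds_unique hlim tendsto_const_nhds
  simp only [Complex.ofReal_mul, ← mul_assoc, integral_mul_const] at hfin
  have hpi : (Real.pi : ℂ) ≠ 0 := by exact_mod_cast Real.pi_ne_zero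
  rw [mul_eq_zero, or_iff_left hpi] at hfin
  simpa [mul_comm] using hfin

end PoissonUniqueness

lemma ofReal_add_ne_zero {u : ℂ} (hu : u.im ≠ 0) (x : ℝ) : (x : ℂ) + u ≠ 0 := fun h =>
  hu (by simpa using congrArg Complex.im h)

lemma ofReal_sub_ne_zero {u : ℂ} (hu : u.im ≠ 0) (x : ℝ) : (x : ℂ) - u ≠ 0 := by
  simpa [sub_eq_add_neg] using ofReal_add_ne_zero (u := -u) (by simpa using hu) x

lemma norm_ofReal_add_div_le {u w : ℂ} (hu : u.im ≠ 0) (x : ℝ) :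
    ‖((x : ℂ) + w) / ((x : ℂ) + u)‖ ≤ 1 + ‖w - u‖ / |u.im| := by
  have h1 : ((x : ℂ) + w) / ((x : ℂ) + u) = 1 + (w - u) / ((x : ℂ) + u) := by
    field_simp [ofReal_add_ne_zero hu x]; ring
  have h2 : |u.im| ≤ ‖(x : ℂ) + u‖ := by simpa using Complex.abs_im_le_norm ((x : ℂ) + u)
  rw [h1]
  refine (norm_add_le _ _).trans ?_
  rw [norm_one, norm_div]
  have := abs_pos.2 hu
  gcongr

lemma measurable_ofReal_add_div (u w : ℂ) :
    Measurable fun x : ℝ => ((x : ℂ) + w) / ((x : ℂ) + u) := by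
  fun_prop

lemma one_add_ofReal_sq_eq (x : ℝ) : (1 + (x : ℂ) ^ 2) = (x + I) * (x - I) := by
  ring_nf; rw [I_sq]; ring

lemma ofReal_add_I_ne_zero (x : ℝ) : (x : ℂ) + I ≠ 0 := ofReal_add_ne_zero (by simp) x

lemma ofReal_sub_I_ne_zero (x : ℝ) : (x : ℂ) - I ≠ 0 := ofReal_sub_ne_zero (by simp) x

lemma integrable_mul_poisson_of_div {f : ℝ → ℂ} (hf : Integrable fun x => f x / (1 + (x : ℂ) ^ 2))
    (s : ℝ) {y : ℝ} (hy : 0 < y) :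
    Integrable fun x => f x * ((y / ((x - s) ^ 2 + y ^ 2) : ℝ) : ℂ) := by
  have him : (-(s : ℂ) + y * I).im ≠ 0 := by simpa using hy.ne'
  have him' : (-(s : ℂ) + -(y * I)).im ≠ 0 := by simpa using hy.ne'
  have := (((hf.bdd_mul (measurable_ofReal_add_div _ I).aestronglyMeasurable
    (Eventually.of_forall (norm_ofReal_add_div_le him))).bdd_mul
    (measurable_ofReal_add_div _ (-I)).aestronglyMeasurable
    (Eventually.of_forall (norm_ofReal_add_div_le him')))).const_mul (y : ℂ)
  refine this.congr (Eventually.of_forall fun x => ?_)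
  have a1 := ofReal_add_I_ne_zero x
  have a2 := ofReal_sub_I_ne_zero x
  have a3 := ofReal_add_ne_zero him x
  have a4 := ofReal_add_ne_zero him' x
  have hd : (((x - s) ^ 2 + y ^ 2 : ℝ) : ℂ) =
      (x + (-(s : ℂ) + y * I)) * (x + (-(s : ℂ) + -(y * I))) := by
    push_cast; ring_nf; rw [I_sq]; ring
  beta_reduce
  rw [Complex.ofReal_div, hd]
  simp only [one_add_ofReal_sq_eq, ← sub_eq_add_neg (x : ℂ) I]
  field_simp

/-- A function annihilated by the Cauchy kernels of both half-planes is constant. -/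
lemma exists_ae_eq_const_of_cauchy {φ : ℝ → ℂ}
    (hφ : Integrable fun x => φ x / (1 + (x : ℂ) ^ 2))
    (h₁ : ∀ u : ℂ, 0 < u.im → ∫ x : ℝ, φ x / ((x + I) * (x + u)) = 0)
    (h₂ : ∀ u : ℂ, 0 < u.im → ∫ x : ℝ, φ x / ((x - I) * (x - u)) = 0) :
    ∃ c : ℂ, ∀ᵐ x, φ x = c := by
  have hpois : ∀ s y : ℝ, 0 < y → ∫ x, φ x * ((y / ((x - s) ^ 2 + y ^ 2) : ℝ) : ℂ) =
      ∫ x, φ x / (1 + (x : ℂ) ^ 2) := by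
    intro s y hy
    set z : ℂ := s + y * I with hz
    set z' : ℂ := s - y * I with hz'
    have hzi : z.im = y := by simp [hz]
    have hzi' : (-z').im = y := by simp [hz']
    have hzx : ∀ x : ℝ, (x : ℂ) - z ≠ 0 := ofReal_sub_ne_zero (by rw [hzi]; exact hy.ne')
    have hzx' : ∀ x : ℝ, (x : ℂ) - z' ≠ 0 := fun x => by
      simpa [sub_eq_add_neg] using ofReal_add_ne_zero (u := -z') (by rw [hzi']; exact hy.ne') x
    have hi1 : Integrable fun x : ℝ => φ x / ((x + I) * (x + -z')) := by
      have := hφ.bdd_mul (measurable_ofReal_add_div (-z') (-I)).aestronglyMeasurable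
        (Eventually.of_forall (norm_ofReal_add_div_le (by rw [hzi']; exact hy.ne')))
      refine this.congr (Eventually.of_forall fun x => ?_)
      have a1 := ofReal_add_I_ne_zero x; have a2 := ofReal_sub_I_ne_zero x; have a3 := hzx' x
      simp only [one_add_ofReal_sq_eq, ← sub_eq_add_neg]
      field_simp
    have hi2 : Integrable fun x : ℝ => φ x / ((x - I) * (x - z)) := by
      have := hφ.bdd_mul (measurable_ofReal_add_div (-z) I).aestronglyMeasurable
        (Eventually.of_forall (norm_ofReal_add_div_le (by simpa [hzi] using hy.ne')))
      refine this.congr (Eventually.of_forall fun x => ?_)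
      have a1 := ofReal_add_I_ne_zero x; have a2 := ofReal_sub_I_ne_zero x; have a3 := hzx x
      simp only [one_add_ofReal_sq_eq, ← sub_eq_add_neg]
      field_simp
    have key : ∀ x : ℝ, φ x * ((y / ((x - s) ^ 2 + y ^ 2) : ℝ) : ℂ) =
        φ x / (1 + (x : ℂ) ^ 2) + ((z - I) / (2 * I)) * (φ x / ((x - I) * (x - z))) -
          ((z' + I) / (2 * I)) * (φ x / ((x + I) * (x + -z'))) := by
      intro x
      have a1 := ofReal_add_I_ne_zero x
      have a2 := ofReal_sub_I_ne_zero x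
      have a3 := hzx x
      have a4 := hzx' x
      have hd : (((x - s) ^ 2 + y ^ 2 : ℝ) : ℂ) = (x - z) * (x - z') := by
        simp only [hz, hz']; push_cast; ring_nf; rw [I_sq]; ring
      have hyz : (y : ℂ) = (z - z') / (2 * I) := by
        simp only [hz, hz']; field_simp; ring
      rw [Complex.ofReal_div, hd, hyz, one_add_ofReal_sq_eq, ← sub_eq_add_neg]
      have := I_ne_zero
      field_simp
      ring
    simp only [key]
    have hi3 : Integrable fun x : ℝ =>
        φ x / (1 + (x : ℂ) ^ 2) + ((z - I) / (2 * I)) * (φ x / ((x - I) * (x - z))) :=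
      hφ.add (hi2.const_mul _)
    rw [integral_sub hi3 (hi1.const_mul _),
      integral_add hφ (hi2.const_mul _), integral_const_mul, integral_const_mul,
      h₁ (-z') (by rw [hzi']; exact hy), h₂ z (by rw [hzi]; exact hy)]
    simp
  set c : ℂ := (∫ x, φ x / (1 + (x : ℂ) ^ 2)) / Real.pi with hc
  have hone : Integrable fun x : ℝ => c / (1 + (x : ℂ) ^ 2) := by
    refine (integrable_inv_one_add_sq.ofReal.const_mul c).congr (Eventually.of_forall fun x => ?_)
    simp [div_eq_mul_inv]
  have hψ : Integrable fun x => (φ x - c) / (1 + (x : ℂ) ^ 2) :=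
    (hφ.sub hone).congr (Eventually.of_forall fun x => by simp [sub_div])
  refine ⟨c, ?_⟩
  have hpi : (Real.pi : ℂ) ≠ 0 := by exact_mod_cast Real.pi_ne_zero
  filter_upwards [ae_eq_zero_of_integral_poisson_eq_zero hψ fun s y hy => by
    simp only [sub_mul]
    rw [integral_sub (integrable_mul_poisson_of_div hφ s hy)
      (integrable_mul_poisson_of_div hone s hy), hpois s y hy, integral_const_mul,
      integral_complex_ofReal]
    have := integral_poisson s hy
    simp only [sub_sq_comm s] at this
    rw [this, hc]
    field_simp
    simp] with x hx
  exact sub_eq_zero.1 hx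

lemma memLp_one_add_sq_rpow {p : ℝ≥0∞} (hp : 1 < p) (hp' : p ≠ ⊤) :
    MemLp (fun x : ℝ => (1 + x ^ 2) ^ (-(1 : ℝ) / 2)) p volume := by
  have hp0 : p ≠ 0 := (zero_lt_one.trans hp).ne'
  have h1 : 1 < p.toReal := by
    rw [← ENNReal.toReal_one]; exact (ENNReal.toReal_lt_toReal ENNReal.one_ne_top hp').2 hp
  have hm : Measurable fun x : ℝ => (1 + x ^ 2) ^ (-(1 : ℝ) / 2) := by fun_prop
  rw [← integrable_norm_rpow_iff hm.aestronglyMeasurable hp0 hp']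
  have := integrable_rpow_neg_one_add_norm_sq (E := ℝ) (μ := volume)
    (r := p.toReal) (by simpa using h1)
  refine this.congr (Eventually.of_forall fun x => ?_)
  have hx : (0 : ℝ) ≤ 1 + x ^ 2 := by positivity
  simp only [Real.norm_eq_abs, sq_abs]
  rw [abs_of_nonneg (by positivity), ← Real.rpow_mul hx]
  congr 1; ring

lemma memLp_inv_ofReal_add {p : ℝ≥0∞} (hp : 1 < p) (hp' : p ≠ ⊤) {u : ℂ} (hu : u.im ≠ 0) :
    MemLp (fun x : ℝ => ((x : ℂ) + u)⁻¹) p volume := by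
  refine (memLp_one_add_sq_rpow hp hp').of_le_mul (c := 1 + ‖I - u‖ / |u.im|)
    (Measurable.aestronglyMeasurable (by fun_prop)) (Eventually.of_forall fun x => ?_)
  have hn : ‖((x : ℂ) + I)⁻¹‖ = ‖(1 + x ^ 2) ^ (-(1 : ℝ) / 2)‖ := by
    rw [norm_inv, Real.norm_of_nonneg (by positivity), neg_div, Real.rpow_neg (by positivity),
      ← Real.sqrt_eq_rpow, Complex.norm_def, Complex.normSq_apply]
    simp [sq, add_comm]
  rw [← hn, ← mul_inv_cancel_right₀ (ofReal_add_I_ne_zero x) ((x : ℂ) + u)⁻¹, norm_mul]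
  gcongr
  rw [mul_comm, ← div_eq_mul_inv]
  exact norm_ofReal_add_div_le hu x

lemma tendsto_inv_ofReal_add (u : ℂ) {l : Filter ℝ} (hl : Tendsto (fun x : ℝ => ‖x‖) l atTop) :
    Tendsto (fun x : ℝ => ((x : ℂ) + u)⁻¹) l (𝓝 0) := by
  refine tendsto_inv₀_cobounded.comp ?_
  rw [tendsto_norm_atTop_iff_cobounded.symm]
  refine tendsto_atTop_mono (fun x => ?_) (tendsto_atTop_add_const_right _ (-‖u‖) hl)
  have := norm_sub_le ((x : ℂ) + u) u
  rw [add_sub_cancel_right, Complex.norm_real] at this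
  linarith

lemma integral_cauchy_mul_cauchy {u w : ℂ} (hu : 0 < u.im) (hw : 0 < w.im) :
    ∫ x : ℝ, ((x : ℂ) + w)⁻¹ / (x + u) = 0 := by
  have hxu := ofReal_add_ne_zero hu.ne'
  have hxw := ofReal_add_ne_zero hw.ne'
  have hint : Integrable fun x : ℝ => ((x : ℂ) + w)⁻¹ / (x + u) :=
    (memLp_inv_ofReal_add (p := 2) (by norm_num) (by norm_num) hw.ne').integrable_mul
      (memLp_inv_ofReal_add (p := 2) (by norm_num) (by norm_num) hu.ne')
  have hder : ∀ (v : ℂ) (x : ℝ), HasDerivAt (fun x : ℝ => (x : ℂ) + v) 1 x := fun v x => by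
    simpa using (Complex.ofRealCLM.hasDerivAt (x := x)).add_const v
  have hbot : Tendsto (fun x : ℝ => ‖x‖) atBot atTop := tendsto_abs_atBot_atTop
  have htop : Tendsto (fun x : ℝ => ‖x‖) atTop atTop := tendsto_abs_atTop_atTop
  by_cases huw : u = w
  · subst huw
    have hF : ∀ x : ℝ, HasDerivAt (fun x : ℝ => -((x : ℂ) + u)⁻¹)
        (((x : ℂ) + u)⁻¹ / (x + u)) x := by
      intro x
      refine ((hder u x).fun_inv (hxu x)).neg.congr_deriv ?_
      rw [neg_div, neg_neg, one_div, sq, mul_inv, div_eq_mul_inv]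
    simpa using integral_of_hasDerivAt_of_tendsto hF hint (tendsto_inv_ofReal_add u hbot).neg
      (tendsto_inv_ofReal_add u htop).neg
  · have hne : u - w ≠ 0 := sub_ne_zero.2 huw
    have hF : ∀ x : ℝ, HasDerivAt (fun x : ℝ => Complex.log (((x : ℂ) + w) / (x + u)) / (u - w))
        (((x : ℂ) + w)⁻¹ / (x + u)) x := by
      intro x
      have hu' := hxu x
      have hw' := hxw x
      have hslit : ((x : ℂ) + w) / (x + u) ∈ Complex.slitPlane := by
        rw [Complex.mem_slitPlane_iff_not_le_zero]
        intro hle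
        obtain ⟨r, hr⟩ : ∃ r : ℝ, ((x : ℂ) + w) / (x + u) = r :=
          ⟨(((x : ℂ) + w) / (x + u)).re,
            Complex.ext (by simp) (by simpa using (Complex.le_def.1 hle).2)⟩
        have hr0 : r ≤ 0 := by rw [hr] at hle; exact_mod_cast hle
        have him := congrArg Complex.im ((div_eq_iff hu').1 hr)
        simp at him
        nlinarith
      refine ((((hder w x).fun_div (hder u x) hu').clog_real hslit).div_const
        (u - w)).congr_deriv ?_
      field_simp
      ring
    have hlim : ∀ l : Filter ℝ, Tendsto (fun x : ℝ => ‖x‖) l atTop →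
        Tendsto (fun x : ℝ => Complex.log (((x : ℂ) + w) / (x + u)) / (u - w)) l (𝓝 0) := by
      intro l hl
      have h1 : Tendsto (fun x : ℝ => ((x : ℂ) + w) / (x + u)) l (𝓝 1) := by
        have := ((tendsto_inv_ofReal_add u hl).const_mul (w - u)).const_add 1
        simp only [mul_zero, add_zero] at this
        refine this.congr fun x => ?_
        have := hxu x
        field_simp
        ring
      have h2 := ((continuousAt_clog Complex.one_mem_slitPlane).tendsto.comp h1).div_const
        (u - w)
      simpa using h2
    simpa using integral_of_hasDerivAt_of_tendsto hF hint (hlim _ hbot) (hlim _ htop)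

lemma integrable_mul_inv_ofReal_add {p : ℝ≥0∞} (hp : 1 < p) (hp' : p ≠ ⊤) (f : LpR p) {u : ℂ}
    (hu : u.im ≠ 0) : Integrable fun x : ℝ => (f : ℝ → ℂ) x * ((x : ℂ) + u)⁻¹ := by
  have hc : ENNReal.HolderConjugate p (ENNReal.conjExponent p) :=
    ENNReal.HolderConjugate.conjExponent hp.le
  have hc' : ENNReal.HolderConjugate (ENNReal.conjExponent p) p := hc.symm
  have h1 : 1 < ENNReal.conjExponent p :=
    (ENNReal.HolderConjugate.lt_top_iff_one_lt p _).1 hp'.lt_top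
  have h2 : ENNReal.conjExponent p ≠ ⊤ :=
    ((ENNReal.HolderConjugate.lt_top_iff_one_lt _ p).2 hp).ne
  exact (Lp.memLp f).integrable_mul (memLp_inv_ofReal_add h1 h2 hu)

/-- The Cauchy kernel `1 / (x + u)` as an element of `L^p`. -/
def cauchyLp {p : ℝ≥0∞} (hp : 1 < p) (hp' : p ≠ ⊤) {u : ℂ} (hu : u.im ≠ 0) : LpR p :=
  (memLp_inv_ofReal_add hp hp' hu).toLp _

lemma coeFn_cauchyLp {p : ℝ≥0∞} (hp : 1 < p) (hp' : p ≠ ⊤) {u : ℂ} (hu : u.im ≠ 0) :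
    (cauchyLp hp hp' hu : ℝ → ℂ) =ᵐ[volume] fun x => ((x : ℂ) + u)⁻¹ :=
  (memLp_inv_ofReal_add hp hp' hu).coeFn_toLp

section Binest

variable {p : ℝ≥0∞} [Fact (1 ≤ p)]

lemma mulHardy_exp_zero :
    mulHardy p (fun x => Complex.exp (Complex.I * ((0 : ℝ) : ℂ) * x)) = hardy p := by
  ext g
  simp only [mulHardy, Complex.ofReal_zero, mul_zero, zero_mul, Complex.exp_zero, one_mul,
    Set.mem_ofPred_eq]
  refine ⟨?_, fun hg => ⟨g, hg, ae_eq_refl _⟩⟩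
  rintro ⟨f, hf, hgf⟩
  rwa [Lp.ext hgf]

lemma map_mem_hardy {T : LpR p →L[ℂ] LpR p} (hT : T ∈ fourierBinest p) {f : LpR p}
    (hf : f ∈ hardy p) : T f ∈ hardy p := by
  have := hT.2 0 f
  rw [mulHardy_exp_zero] at this
  exact this hf

lemma ae_comp_neg {P : ℝ → Prop} (h : ∀ᵐ x, P x) : ∀ᵐ x, P (-x) :=
  (Measure.measurePreserving_neg (volume : Measure ℝ)).quasiMeasurePreserving.ae h

variable {J T : LpR p →L[ℂ] LpR p}

lemma flipOp_flipOp (hJ : ∀ f : LpR p, (J f : ℝ → ℂ) =ᵐ[volume] fun x => (f : ℝ → ℂ) (-x))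
    (f : LpR p) : J (J f) = f := by
  refine Lp.ext ?_
  filter_upwards [hJ (J f), ae_comp_neg (hJ f)] with x h1 h2
  rw [h1, h2, neg_neg]

lemma commutesWithMul_indicator_Ici
    (hJ : ∀ f : LpR p, (J f : ℝ → ℂ) =ᵐ[volume] fun x => (f : ℝ → ℂ) (-x))
    (hT : T ∈ fourierBinest p) (hJTJ : J.comp (T.comp J) ∈ fourierBinest p) (t : ℝ) :
    CommutesWithMul T ((Set.Ici t).indicator fun _ => 1) := by
  intro f g hg
  have h1 : T g ∈ LpHalfLine p t := by
    refine hT.1 t g ?_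
    filter_upwards [hg] with x hx hxt
    simp [hx, hxt]
  have h2 : J (T (f - g)) ∈ LpHalfLine p (-t) := by
    have hmem : J (f - g) ∈ LpHalfLine p (-t) := by
      filter_upwards [hJ (f - g), ae_comp_neg (Lp.coeFn_sub f g), ae_comp_neg hg]
        with x h1 h2 h3 hxt
      rw [h1, h2, Pi.sub_apply, h3, Set.indicator_of_mem (Set.mem_Ici.2 (by linarith)), one_mul,
        sub_self]
    have := hJTJ.1 (-t) _ hmem
    rwa [ContinuousLinearMap.comp_apply, ContinuousLinearMap.comp_apply, flipOp_flipOp hJ] at this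
  have h3 : ∀ᵐ x, t < x → (T (f - g) : ℝ → ℂ) x = 0 := by
    filter_upwards [ae_comp_neg h2, ae_comp_neg (hJ (T (f - g)))] with x hx hx' hxt
    rw [← neg_neg x, ← hx', hx (by linarith)]
  have h4 : T f = T g + T (f - g) := by rw [← map_add]; congr 1; abel
  filter_upwards [h1, h3, Lp.coeFn_add (T g) (T (f - g)), Measure.ae_ne volume t]
    with x hx1 hx3 hx4 hxt
  rw [h4, hx4, Pi.add_apply]
  rcases lt_or_gt_of_ne hxt with h | h
  · rw [hx1 h, Set.indicator_of_notMem (by simpa using h), zero_mul]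
  · rw [hx3 h, Set.indicator_of_mem (Set.mem_Ici.2 h.le), one_mul, add_zero]

lemma cauchyLp_mem_hardy (hp : 1 < p) (hp' : p ≠ ⊤) {w : ℂ} (hw : 0 < w.im) :
    cauchyLp hp hp' hw.ne' ∈ hardy p := by
  intro u hu
  rw [← integral_cauchy_mul_cauchy hu hw]
  refine integral_congr_ae ?_
  filter_upwards [coeFn_cauchyLp hp hp' hw.ne'] with x hx
  rw [hx]

lemma I_im_pos : 0 < I.im := by simp

lemma neg_I_im_ne_zero : (-I).im ≠ 0 := by simp

lemma integral_map_cauchyLp_neg_I_div (hp : 1 < p) (hp' : p ≠ ⊤)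
    (hJ : ∀ f : LpR p, (J f : ℝ → ℂ) =ᵐ[volume] fun x => (f : ℝ → ℂ) (-x))
    (hJTJ : J.comp (T.comp J) ∈ fourierBinest p) {u : ℂ} (hu : 0 < u.im) :
    ∫ x : ℝ, (T (cauchyLp hp hp' neg_I_im_ne_zero) : ℝ → ℂ) x / (x - u) = 0 := by
  have hflip : J (cauchyLp hp hp' I_im_pos.ne') = -cauchyLp hp hp' neg_I_im_ne_zero := by
    refine Lp.ext ?_
    filter_upwards [hJ (cauchyLp hp hp' I_im_pos.ne'), coeFn_cauchyLp hp hp' neg_I_im_ne_zero,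
      ae_comp_neg (coeFn_cauchyLp hp hp' I_im_pos.ne'),
      Lp.coeFn_neg (cauchyLp hp hp' neg_I_im_ne_zero)] with x h1 h2 h3 h4
    rw [h1, h3, h4, Pi.neg_apply, h2, ← inv_neg]
    push_cast
    ring
  have hmem := map_mem_hardy hJTJ (cauchyLp_mem_hardy hp hp' I_im_pos) u hu
  simp only [ContinuousLinearMap.comp_apply, hflip, map_neg] at hmem
  rw [← integral_neg_eq_self, ← hmem]
  refine integral_congr_ae ?_
  filter_upwards [hJ (T (cauchyLp hp hp' neg_I_im_ne_zero)),
    Lp.coeFn_neg (J (T (cauchyLp hp hp' neg_I_im_ne_zero)))] with x h1 h2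
  rw [h2, Pi.neg_apply, h1, Complex.ofReal_neg, neg_div, ← div_neg]
  congr 1
  ring

lemma exists_map_cauchyLp_I_eq_smul (hp : 1 < p) (hp' : p ≠ ⊤)
    (hJ : ∀ f : LpR p, (J f : ℝ → ℂ) =ᵐ[volume] fun x => (f : ℝ → ℂ) (-x))
    (hT : T ∈ fourierBinest p) (hJTJ : J.comp (T.comp J) ∈ fourierBinest p) :
    ∃ c : ℂ, T (cauchyLp hp hp' I_im_pos.ne') = c • cauchyLp hp hp' I_im_pos.ne' := by
  set F := T (cauchyLp hp hp' I_im_pos.ne') with hF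
  have hG : (T (cauchyLp hp hp' neg_I_im_ne_zero) : ℝ → ℂ) =ᵐ[volume]
      fun x => ((x : ℂ) + I) / (x + -I) * (F : ℝ → ℂ) x := by
    refine CommutesWithMul.of_bounded hp' (commutesWithMul_indicator_Ici hJ hT hJTJ)
      (measurable_ofReal_add_div (-I) I) (norm_ofReal_add_div_le neg_I_im_ne_zero) _ _ ?_
    filter_upwards [coeFn_cauchyLp hp hp' neg_I_im_ne_zero, coeFn_cauchyLp hp hp' I_im_pos.ne']
      with x h1 h2
    have := ofReal_add_I_ne_zero x
    rw [h1, h2]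
    field_simp
  suffices h : ∃ c : ℂ, ∀ᵐ x : ℝ, (F : ℝ → ℂ) x * (x + I) = c by
    obtain ⟨c, hc⟩ := h
    refine ⟨c, Lp.ext ?_⟩
    filter_upwards [hc, coeFn_cauchyLp hp hp' I_im_pos.ne',
      Lp.coeFn_smul c (cauchyLp hp hp' I_im_pos.ne')] with x h1 h2 h3
    have := ofReal_add_I_ne_zero x
    rw [h3, Pi.smul_apply, h2, smul_eq_mul, ← h1]
    field_simp
  refine exists_ae_eq_const_of_cauchy ?_ ?_ ?_
  · refine (integrable_mul_inv_ofReal_add hp hp' F neg_I_im_ne_zero).congr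
      (Eventually.of_forall fun x => ?_)
    have a1 := ofReal_add_I_ne_zero x
    have a2 := ofReal_sub_I_ne_zero x
    simp only [one_add_ofReal_sq_eq, ← sub_eq_add_neg]
    field_simp
  · intro u hu
    rw [← map_mem_hardy hT (cauchyLp_mem_hardy hp hp' I_im_pos) u hu]
    refine integral_congr_ae (Eventually.of_forall fun x => ?_)
    have a1 := ofReal_add_I_ne_zero x
    have a2 := ofReal_add_ne_zero hu.ne' x
    simp only [← hF]
    field_simp
  · intro u hu
    rw [← integral_map_cauchyLp_neg_I_div hp hp' hJ hJTJ hu]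
    refine integral_congr_ae ?_
    filter_upwards [hG] with x hx
    have a1 := ofReal_sub_I_ne_zero x
    have a2 := ofReal_sub_ne_zero hu.ne' x
    rw [hx, ← sub_eq_add_neg]
    field_simp

lemma eq_smul_id_of_map_cauchyLp (hp : 1 < p) (hp' : p ≠ ⊤)
    (hT : ∀ t : ℝ, CommutesWithMul T ((Set.Ici t).indicator fun _ => 1)) {c : ℂ}
    (hc : T (cauchyLp hp hp' I_im_pos.ne') = c • cauchyLp hp hp' I_im_pos.ne') :
    T = c • ContinuousLinearMap.id ℂ (LpR p) := by
  ext1 f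
  obtain ⟨f', hf'm, hff'⟩ := Lp.aestronglyMeasurable f
  have hkm : Measurable fun x => f' x * ((x : ℂ) + I) := hf'm.measurable.mul (by fun_prop)
  have hE : ∀ n : ℕ, MeasurableSet {x : ℝ | ‖f' x * ((x : ℂ) + I)‖ ≤ n} := fun n =>
    measurableSet_le hkm.norm measurable_const
  have hkey : ∀ n : ℕ, ∀ᵐ x, ‖f' x * ((x : ℂ) + I)‖ ≤ n →
      (T f : ℝ → ℂ) x = c * (f : ℝ → ℂ) x := by
    intro n
    set E := {x : ℝ | ‖f' x * ((x : ℂ) + I)‖ ≤ n} with hEdef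
    set h : ℝ → ℂ := E.indicator fun x => f' x * ((x : ℂ) + I) with hh
    have hhm : Measurable h := hkm.indicator (hE n)
    have hhb : ∀ x, ‖h x‖ ≤ n := fun x => by
      by_cases hx : x ∈ E
      · rw [hh, Set.indicator_of_mem hx]; exact hx
      · rw [hh, Set.indicator_of_notMem hx, norm_zero]; exact n.cast_nonneg
    obtain ⟨g, hg⟩ := exists_lp_eq_mul (measurable_indicator_one (hE n))
      (norm_indicator_one_le E) f
    have hg' : (g : ℝ → ℂ) =ᵐ[volume]
        fun x => h x * (cauchyLp hp hp' I_im_pos.ne' : ℝ → ℂ) x := by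
      filter_upwards [hg, hff', coeFn_cauchyLp hp hp' I_im_pos.ne'] with x h1 h2 h3
      rw [h1, h2, h3]
      by_cases hx : x ∈ E
      · have := ofReal_add_I_ne_zero x
        rw [hh, Set.indicator_of_mem hx, Set.indicator_of_mem hx]
        field_simp
      · rw [hh, Set.indicator_of_notMem hx, Set.indicator_of_notMem hx, zero_mul, zero_mul]
    filter_upwards [CommutesWithMul.indicator_of_Ici hp' hT (hE n) f g hg,
      CommutesWithMul.of_bounded hp' hT hhm hhb _ g hg', hg, hg',
      Lp.coeFn_smul c (cauchyLp hp hp' I_im_pos.ne')] with x h1 h2 h3 h4 h5 hx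
    rw [Set.indicator_of_mem (show x ∈ E from hx), one_mul] at h1 h3
    rw [← h1, h2, hc, h5, Pi.smul_apply, smul_eq_mul, mul_left_comm, ← h4, h3]
  refine Lp.ext ?_
  rw [smul_apply, ContinuousLinearMap.id_apply]
  filter_upwards [ae_all_iff.2 hkey, Lp.coeFn_smul c f] with x hx h2
  obtain ⟨n, hn⟩ := exists_nat_ge ‖f' x * ((x : ℂ) + I)‖
  rw [hx n hn, h2, Pi.smul_apply, smul_eq_mul]

end Binest

/-- The Fourier binest algebra is antisymmetric: with `J` the flip
operator `(Jf)(x) = f(-x)`, if `T ∈ A_FB^p` and `JTJ ∈ A_FB^p` then `T` is a scalar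
multiple of the identity. -/
theorem fourierBinest_antisymmetric
    (p : ℝ≥0∞) [Fact (1 ≤ p)] (hp : 1 < p) (hp' : p ≠ ⊤)
    (J T : LpR p →L[ℂ] LpR p)
    (hJ : ∀ f : LpR p, (J f : ℝ → ℂ) =ᵐ[volume] fun x => (f : ℝ → ℂ) (-x))
    (hT : T ∈ fourierBinest p)
    (hJTJ : J.comp (T.comp J) ∈ fourierBinest p) :
    ∃ c : ℂ, T = c • ContinuousLinearMap.id ℂ (LpR p) := by
  obtain ⟨c, hc⟩ := exists_map_cauchyLp_I_eq_smul hp hp' hJ hT hJTJ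
  exact ⟨c, eq_smul_id_of_map_cauchyLp hp hp' (commutesWithMul_indicator_Ici hJ hT hJTJ) hc⟩

end
end
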